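/- arXiv:1804.07267 — 2 statements merged into one kernel-verified Lean document; each statement's English description precedes it below -/
import Mathlib

section
/- For every n ≥ 3, the number of quasi-Stirling permutations of the multiset [n,n] that avoid all of the patterns 123, 132, 231, and 312 equals 3. -/
/-- `π : Fin (2*n) → Fin n` encodes a permutation of the multiset
`{1,1,2,2,…,n,n}`: every value appears exactly twice. -/
def IsMultisetPerm (n : ℕ) (π : Fin (2 * n) → Fin n) : Prop :=
  ∀ v : Fin n, Nat.card {i : Fin (2 * n) // π i = v} = 2

/-- `π` avoids the pattern 1212. -/
def Avoids1212 (n : ℕ) (π : Fin (2 * n) → Fin n) : Prop :=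
  ¬ ∃ i j k l : Fin (2 * n), i < j ∧ j < k ∧ k < l ∧
      π i = π k ∧ π j = π l ∧ π i < π j

/-- `π` avoids the pattern 2121. -/
def Avoids2121 (n : ℕ) (π : Fin (2 * n) → Fin n) : Prop :=
  ¬ ∃ i j k l : Fin (2 * n), i < j ∧ j < k ∧ k < l ∧
      π i = π k ∧ π j = π l ∧ π j < π i

/-- A quasi-Stirling permutation: a permutation of the multiset `[n,n]`
avoiding both 1212 and 2121. -/
def IsQuasiStirling (n : ℕ) (π : Fin (2 * n) → Fin n) : Prop :=
  IsMultisetPerm n π ∧ Avoids1212 n π ∧ Avoids2121 n π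

/-- `π` contains the length-3 pattern `σ` (with distinct entries):
there are positions `i₁ < i₂ < i₃` whose values are in the same relative
order as `σ`. -/
def Contains3 (n : ℕ) (σ : Fin 3 → ℕ) (π : Fin (2 * n) → Fin n) : Prop :=
  ∃ f : Fin 3 → Fin (2 * n), StrictMono f ∧
    ∀ a b : Fin 3, π (f a) < π (f b) ↔ σ a < σ b

/-- `π` avoids the length-3 pattern `σ`. -/
def Avoids3 (n : ℕ) (σ : Fin 3 → ℕ) (π : Fin (2 * n) → Fin n) : Prop :=
  ¬ Contains3 n σ π

/-- In a permutation of `[n,n]`, a set `T` of values occupies `2 * #T` positions. -/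
lemma IsMultisetPerm.card_preimage {n : ℕ} {π : Fin (2 * n) → Fin n}
    (h : IsMultisetPerm n π) (T : Finset (Fin n)) :
    (Finset.univ.filter fun i => π i ∈ T).card = 2 * T.card := by
  rw [Finset.card_eq_sum_card_fiberwise (f := π) (t := T) (fun i hi => by simpa using hi)]
  rw [Finset.sum_congr rfl (g := fun _ => 2), Finset.sum_const, smul_eq_mul, mul_comm]
  intro v hv
  refine Eq.trans ?_ (h v)
  rw [Nat.card_eq_fintype_card, Fintype.card_subtype, Finset.filter_filter]
  congr 1
  ext i
  simp only [Finset.mem_filter, Finset.mem_univ, true_and]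
  exact ⟨fun hi => hi.2, fun hi => ⟨hi ▸ hv, hi⟩⟩

/-- Containment of a length-3 pattern from explicit positions. -/
lemma contains3_of_lt {n : ℕ} {π : Fin (2 * n) → Fin n} {σ : Fin 3 → ℕ} {i j k : Fin (2 * n)}
    (hij : i < j) (hjk : j < k)
    (h : ∀ a b : Fin 3, ![π i, π j, π k] a < ![π i, π j, π k] b ↔ σ a < σ b) :
    Contains3 n σ π := by
  refine ⟨![i, j, k], ?_, ?_⟩
  · rw [Fin.strictMono_iff_lt_succ]
    intro a
    fin_cases a
    · exact hij
    · exact hjk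
  · intro a b
    have e : ∀ c : Fin 3, π (![i, j, k] c) = ![π i, π j, π k] c := by
      intro c
      fin_cases c <;> rfl
    rw [e, e]
    exact h a b

/-- The word `n^s (n-1)(n-1) ⋯ 1 1 n^(2-s)`, with values shifted to `0, …, n - 1`. -/
def descendingWord (n s : ℕ) (hn : 0 < n) (i : Fin (2 * n)) : Fin n :=
  ⟨if s ≤ i.val ∧ i.val < s + (2 * n - 2) then n - 2 - (i.val - s) / 2 else n - 1, by
    split_ifs <;> omega⟩

lemma descendingWord_isMultisetPerm {n s : ℕ} (hn : 0 < n) (hs : s ≤ 2) :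
    IsMultisetPerm n (descendingWord n s hn) := by
  intro v
  obtain ⟨a, b, hab, h⟩ : ∃ a b : Fin (2 * n), a ≠ b ∧
      ∀ i, descendingWord n s hn i = v ↔ i = a ∨ i = b := by
    by_cases hM : v.val = n - 1
    · refine ⟨⟨if s = 0 then 2 * n - 2 else 0, by split_ifs <;> omega⟩,
        ⟨if s = 2 then 1 else 2 * n - 1, by split_ifs <;> omega⟩, ?_, ?_⟩
      · intro h
        rw [Fin.ext_iff] at h
        dsimp only at h
        split_ifs at h <;> omega
      · intro i
        have hi := i.isLt
        simp only [descendingWord, Fin.ext_iff, hM]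
        split_ifs <;> omega
    · have hv := v.isLt
      refine ⟨⟨s + 2 * (n - 2 - v.val), by omega⟩,
        ⟨s + 2 * (n - 2 - v.val) + 1, by omega⟩, ?_, ?_⟩
      · simp only [ne_eq, Fin.ext_iff]
        omega
      · intro i
        have hi := i.isLt
        simp only [descendingWord, Fin.ext_iff]
        split_ifs <;> omega
  rw [Nat.subtype_card {a, b} (by simpa using fun i => (h i).symm), Finset.card_pair hab]

/-- An ascent of `descendingWord` ends in its final block of maxima. -/
lemma descendingWord_of_lt {n s : ℕ} (hn : 0 < n) {i j : Fin (2 * n)} (hij : i < j)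
    (h : descendingWord n s hn i < descendingWord n s hn j) :
    s ≤ i.val ∧ s + (2 * n - 2) ≤ j.val := by
  simp only [descendingWord, Fin.lt_def] at h hij
  have hj := j.isLt
  split_ifs at h <;> omega

/-- A descent of `descendingWord` ends before its final block of maxima. -/
lemma descendingWord_of_gt {n s : ℕ} (hn : 0 < n) {i j : Fin (2 * n)}
    (h : descendingWord n s hn j < descendingWord n s hn i) :
    s ≤ j.val ∧ j.val < s + (2 * n - 2) := by
  simp only [descendingWord, Fin.lt_def] at h
  split_ifs at h <;> omega

lemma descendingWord_isQuasiStirling {n s : ℕ} (hn : 0 < n) (hs : s ≤ 2) :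
    IsQuasiStirling n (descendingWord n s hn) := by
  refine ⟨descendingWord_isMultisetPerm hn hs, ?_, ?_⟩
  · rintro ⟨i, j, k, l, hij, hjk, hkl, hik, hjl, h⟩
    have h1 := descendingWord_of_lt hn hij h
    have h2 := descendingWord_of_gt hn (hik ▸ h)
    simp only [Fin.lt_def] at *
    omega
  · rintro ⟨i, j, k, l, hij, hjk, hkl, hik, hjl, h⟩
    have h1 := descendingWord_of_gt hn h
    have h2 := descendingWord_of_lt hn hjk (hik ▸ h)
    have h3 := descendingWord_of_gt hn (hjl ▸ h)
    simp only [Fin.lt_def] at *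
    omega

lemma descendingWord_avoids3 {n s : ℕ} (hn : 0 < n) :
    Avoids3 n ![1, 2, 3] (descendingWord n s hn) ∧
      Avoids3 n ![1, 3, 2] (descendingWord n s hn) ∧
      Avoids3 n ![2, 3, 1] (descendingWord n s hn) ∧
      Avoids3 n ![3, 1, 2] (descendingWord n s hn) := by
  refine ⟨?_, ?_, ?_, ?_⟩ <;> rintro ⟨f, hf, h⟩ <;>
    have h01 : f 0 < f 1 := hf (by decide) <;>
    have h12 : f 1 < f 2 := hf (by decide)
  · have a := descendingWord_of_lt hn h01 ((h 0 1).2 (by decide))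
    have b := (h 1 2).2 (by decide)
    have c := descendingWord_of_gt hn b
    simp only [Fin.lt_def] at *
    omega
  · have a := descendingWord_of_lt hn h01 ((h 0 1).2 (by decide))
    have b := descendingWord_of_gt hn ((h 2 1).2 (by decide))
    simp only [Fin.lt_def] at *
    omega
  · have a := descendingWord_of_lt hn h01 ((h 0 1).2 (by decide))
    have b := descendingWord_of_gt hn ((h 2 0).2 (by decide))
    simp only [Fin.lt_def] at *
    omega
  · have a := descendingWord_of_lt hn h12 ((h 1 2).2 (by decide))
    have b := descendingWord_of_gt hn ((h 2 0).2 (by decide))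
    simp only [Fin.lt_def] at *
    omega

lemma descendingWord_injective {n s t : ℕ} (hn : 2 ≤ n) (hs : s ≤ 2) (ht : t ≤ 2)
    (h : descendingWord n s (by omega) = descendingWord n t (by omega)) : s = t := by
  have h0 := congrArg Fin.val (congrFun h ⟨0, by omega⟩)
  have h1 := congrArg Fin.val (congrFun h ⟨1, by omega⟩)
  simp only [descendingWord] at h0 h1
  split_ifs at h0 h1 <;> omega

lemma exists_eq_descendingWord {n : ℕ} (hn : 3 ≤ n) {π : Fin (2 * n) → Fin n}
    (hπ : IsMultisetPerm n π) (h123 : Avoids3 n ![1, 2, 3] π) (h132 : Avoids3 n ![1, 3, 2] π)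
    (h231 : Avoids3 n ![2, 3, 1] π) (h312 : Avoids3 n ![3, 1, 2] π) :
    ∃ s ≤ 2, π = descendingWord n s (by omega) := by
  have no123 : ∀ i j k, i < j → j < k → π i < π j → π j < π k → False := by
    refine fun i j k hij hjk h1 h2 => h123 (contains3_of_lt hij hjk fun a b => ?_)
    have := h1.trans h2
    fin_cases a <;> fin_cases b <;> simp [*, le_of_lt]
  have no132 : ∀ i j k, i < j → j < k → π i < π k → π k < π j → False := by
    refine fun i j k hij hjk h1 h2 => h132 (contains3_of_lt hij hjk fun a b => ?_)
    have := h1.trans h2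
    fin_cases a <;> fin_cases b <;> simp [*, le_of_lt]
  have no231 : ∀ i j k, i < j → j < k → π k < π i → π i < π j → False := by
    refine fun i j k hij hjk h1 h2 => h231 (contains3_of_lt hij hjk fun a b => ?_)
    have := h1.trans h2
    fin_cases a <;> fin_cases b <;> simp [*, le_of_lt]
  have no312 : ∀ i j k, i < j → j < k → π j < π k → π k < π i → False := by
    refine fun i j k hij hjk h1 h2 => h312 (contains3_of_lt hij hjk fun a b => ?_)
    have := h1.trans h2
    fin_cases a <;> fin_cases b <;> simp [*, le_of_lt]
  have surj : ∀ v, ∃ i, π i = v := by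
    intro v
    have : 0 < Nat.card {i // π i = v} := by rw [hπ v]; norm_num
    obtain ⟨⟨i, hi⟩⟩ := (Nat.card_pos_iff.1 this).1
    exact ⟨i, hi⟩
  obtain ⟨M, hM⟩ : ∃ M : Fin n, M.val = n - 1 := ⟨⟨n - 1, by omega⟩, rfl⟩
  have ltM : ∀ {v : Fin n}, v ≠ M → v < M := by
    intro v hv
    have := v.isLt
    rw [ne_eq, Fin.ext_iff] at hv
    rw [Fin.lt_def]
    omega
  have anti : ∀ i j, i < j → π j ≠ M → π j ≤ π i := by
    intro i j hij hj
    by_contra! hlt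
    obtain ⟨k, hk⟩ := surj M
    have hjM : π j < π k := hk ▸ ltM hj
    rcases lt_trichotomy k i with h | rfl | h
    · exact no312 k i j h hij hlt hjM
    · exact absurd (hlt.trans hjM) (lt_irrefl _)
    rcases lt_trichotomy k j with h' | rfl | h'
    · exact no132 i k j h h' hlt hjM
    · exact hj hk
    · exact no123 i j k hij h' hlt hjM
  have sep : ∀ k i j, π k = M → π i ≠ M → π j ≠ M → i < k → k < j → False := by
    have eq : ∀ k i j, π k = M → π i ≠ M → π j ≠ M → i < k → k < j → π i = π j := by
      intro k i j hk hi hj hik hkj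
      rcases lt_trichotomy (π i) (π j) with h | h | h
      · exact (no132 i k j hik hkj h (hk ▸ ltM hj)).elim
      · exact h
      · exact (no231 i k j hik hkj h (hk ▸ ltM hi)).elim
    intro k i j hk hi hj hik hkj
    have all : ∀ p, π p ≠ M → π p = π i := by
      intro p hp
      rcases lt_trichotomy p k with h | rfl | h
      · rw [eq k p j hk hp hj h hkj, eq k i j hk hi hj hik hkj]
      · exact absurd hk hp
      · exact (eq k i p hk hi hp hik h).symm
    obtain ⟨p, hp⟩ := surj ⟨0, by omega⟩
    obtain ⟨q, hq⟩ := surj ⟨1, by omega⟩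
    have h1 := all p (by rw [hp, ne_eq, Fin.ext_iff]; simp only; omega)
    have h2 := all q (by rw [hq, ne_eq, Fin.ext_iff]; simp only; omega)
    have := h1.trans h2.symm
    rw [hp, hq, Fin.ext_iff] at this
    simp at this
  obtain ⟨p₀, hp₀⟩ := surj ⟨0, by omega⟩
  have hp₀M : π p₀ ≠ M := by rw [hp₀, ne_eq, Fin.ext_iff]; simp only; omega
  obtain ⟨s, hs⟩ : ∃ s, s = (Finset.univ.filter fun j => π j = M ∧ j < p₀).card := ⟨_, rfl⟩
  have hs2 : s ≤ 2 := by
    have := hπ.card_preimage {M}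
    rw [Finset.card_singleton] at this
    refine hs.trans_le (le_trans ?_ this.le)
    refine Finset.card_le_card fun j => ?_
    simp +contextual
  have before : ∀ p, π p ≠ M → (Finset.univ.filter fun j => π j = M ∧ j < p).card = s := by
    intro p hp
    rw [hs]
    congr 1
    ext j
    simp only [Finset.mem_filter, Finset.mem_univ, true_and]
    refine and_congr_right fun hj => ⟨fun h => ?_, fun h => ?_⟩ <;> by_contra! h'
    · exact sep j p₀ p hj hp₀M hp
        (lt_of_le_of_ne h' fun e => hp₀M (e ▸ hj)) h |>.elim
    · exact sep j p p₀ hj hp hp₀M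
        (lt_of_le_of_ne h' fun e => hp (e ▸ hj)) h |>.elim
  have key : ∀ p, π p ≠ M → s + 2 * (n - 2 - (π p).val) ≤ p.val ∧
      p.val < s + 2 * (n - 1 - (π p).val) := by
    intro p hp
    have hsplit : s + (Finset.univ.filter fun j => π j ≠ M ∧ j < p).card = p.val := by
      rw [← before p hp, ← Finset.card_union_of_disjoint, ← Fin.card_Iio p]
      · congr 1
        ext j
        simp only [Finset.mem_union, Finset.mem_filter, Finset.mem_univ, true_and, Finset.mem_Iio]
        tauto
      · rw [Finset.disjoint_filter]
        exact fun j _ h h' => h'.1 h.1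
    have hlow := hπ.card_preimage (Finset.Ioo (π p) M)
    have hupp := hπ.card_preimage (Finset.Ico (π p) M)
    rw [Fin.card_Ioo] at hlow
    rw [Fin.card_Ico] at hupp
    have h1 : (Finset.univ.filter fun j => π j ∈ Finset.Ioo (π p) M).card ≤
        (Finset.univ.filter fun j => π j ≠ M ∧ j < p).card := by
      refine Finset.card_le_card fun j => ?_
      simp only [Finset.mem_filter, Finset.mem_univ, true_and, Finset.mem_Ioo]
      rintro ⟨ha, hb⟩
      refine ⟨hb.ne, ?_⟩
      by_contra! hpj
      rcases hpj.eq_or_lt with rfl | hpj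
      · exact lt_irrefl _ ha
      · exact absurd (anti p j hpj hb.ne) (not_le.2 ha)
    have h2 : (Finset.univ.filter fun j => π j ≠ M ∧ j < p).card <
        (Finset.univ.filter fun j => π j ∈ Finset.Ico (π p) M).card := by
      refine Finset.card_lt_card ((Finset.ssubset_iff_of_subset fun j => ?_).2 ⟨p, ?_, ?_⟩)
      · simp only [Finset.mem_filter, Finset.mem_univ, true_and, Finset.mem_Ico]
        exact fun h => ⟨anti j p h.2 hp, ltM h.1⟩
      · simpa using ltM hp
      · simp
    omega
  refine ⟨s, hs2, ?_⟩
  have hN : (Finset.univ.filter fun j => π j ≠ M) =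
      Finset.univ.filter fun j : Fin (2 * n) => s ≤ j.val ∧ j.val < s + (2 * n - 2) := by
    refine Finset.eq_of_subset_of_card_le (fun j => ?_) ?_
    · simp only [Finset.mem_filter, Finset.mem_univ, true_and]
      intro hj
      have := key j hj
      omega
    · have h := hπ.card_preimage {M}ᶜ
      simp only [Finset.mem_compl, Finset.mem_singleton, Finset.card_compl, Fintype.card_fin,
        Finset.card_singleton] at h
      rw [ne_eq] at *
      rw [h, ← Finset.card_map Fin.valEmbedding]
      calc _ ≤ (Finset.Ico s (s + (2 * n - 2))).card := by
            refine Finset.card_le_card fun x => ?_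
            simp only [Finset.mem_map, Finset.mem_filter, Finset.mem_univ, true_and,
              Fin.valEmbedding_apply, Finset.mem_Ico]
            rintro ⟨j, hj, rfl⟩
            exact hj
        _ ≤ _ := by rw [Nat.card_Ico]; omega
  ext p
  have hp : π p ≠ M ↔ s ≤ p.val ∧ p.val < s + (2 * n - 2) := by
    simpa using congrArg (p ∈ ·) hN
  simp only [descendingWord]
  split_ifs with h
  · have hk := key p (hp.2 h)
    have := Fin.lt_def.1 (ltM (hp.2 h))
    omega
  · rw [not_not.1 (mt hp.1 h), hM]

theorem quasiStirling_avoiding_123_132_231_312 (n : ℕ) (hn : 3 ≤ n) :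
    Nat.card {π : Fin (2 * n) → Fin n //
      IsQuasiStirling n π ∧ Avoids3 n ![1, 2, 3] π ∧ Avoids3 n ![1, 3, 2] π ∧
        Avoids3 n ![2, 3, 1] π ∧ Avoids3 n ![3, 1, 2] π} = 3 := by
  have hn0 : 0 < n := by omega
  refine Eq.trans (Nat.card_congr (Equiv.ofBijective (fun s : Fin 3 => ⟨descendingWord n s hn0,
    descendingWord_isQuasiStirling hn0 (by omega), descendingWord_avoids3 hn0⟩) ⟨?_, ?_⟩)).symm (Nat.card_fin 3)
  · intro s t h
    exact Fin.ext (descendingWord_injective (by omega) (by omega) (by omega)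
      (congrArg Subtype.val h))
  · rintro ⟨π, hQ, h1, h2, h3, h4⟩
    obtain ⟨s, hs, rfl⟩ := exists_eq_descendingWord hn hQ.1 h1 h2 h3 h4
    exact ⟨⟨s, by omega⟩, rfl⟩
end

section
/- For every n ≥ 3, the number of quasi-Stirling permutations of the multiset [n,n] that avoid all of the patterns 132, 213, 231, and 312 equals 2. -/
theorem Contains3.of_lt_iff {n : ℕ} {σ : Fin 3 → ℕ} {π : Fin (2 * n) → Fin n}
    {i j k : Fin (2 * n)} (hij : i < j) (hjk : j < k)
    (h : ∀ a b : Fin 3, π (![i, j, k] a) < π (![i, j, k] b) ↔ σ a < σ b) :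
    Contains3 n σ π :=
  ⟨![i, j, k], by
    rw [Fin.strictMono_iff_lt_succ]
    intro a
    fin_cases a <;> simpa, h⟩

/-- For three distinct values, avoiding the four non-monotone patterns forces any two pairs of
positions sharing a position to be both in order or both inverted. -/
theorem lt_iff_iff_lt_iff_of_avoids {n : ℕ} {π : Fin (2 * n) → Fin n}
    (h132 : Avoids3 n ![1, 3, 2] π) (h213 : Avoids3 n ![2, 1, 3] π)
    (h231 : Avoids3 n ![2, 3, 1] π) (h312 : Avoids3 n ![3, 1, 2] π)
    (i j k : Fin (2 * n)) (hij : π i ≠ π j) (hik : π i ≠ π k) (hjk : π j ≠ π k) :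
    ((i < j ↔ π i < π j) ↔ (i < k ↔ π i < π k)) := by
  have g132 : ∀ i j k, i < j → j < k → ¬ (π i < π k ∧ π k < π j) := by
    rintro i j k hij hjk ⟨h₁, h₂⟩
    refine h132 (.of_lt_iff hij hjk fun a b ↦ ?_)
    fin_cases a <;> fin_cases b <;> simp <;> order
  have g213 : ∀ i j k, i < j → j < k → ¬ (π j < π i ∧ π i < π k) := by
    rintro i j k hij hjk ⟨h₁, h₂⟩
    refine h213 (.of_lt_iff hij hjk fun a b ↦ ?_)
    fin_cases a <;> fin_cases b <;> simp <;> order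
  have g231 : ∀ i j k, i < j → j < k → ¬ (π k < π i ∧ π i < π j) := by
    rintro i j k hij hjk ⟨h₁, h₂⟩
    refine h231 (.of_lt_iff hij hjk fun a b ↦ ?_)
    fin_cases a <;> fin_cases b <;> simp <;> order
  have g312 : ∀ i j k, i < j → j < k → ¬ (π j < π k ∧ π k < π i) := by
    rintro i j k hij hjk ⟨h₁, h₂⟩
    refine h312 (.of_lt_iff hij hjk fun a b ↦ ?_)
    fin_cases a <;> fin_cases b <;> simp <;> order
  have eij : i ≠ j := fun h ↦ hij (congrArg π h)
  have eik : i ≠ k := fun h ↦ hik (congrArg π h)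
  have ejk : j ≠ k := fun h ↦ hjk (congrArg π h)
  grind

theorem IsMultisetPerm.exists_eq {n : ℕ} {π : Fin (2 * n) → Fin n} (h : IsMultisetPerm n π)
    (v : Fin n) : ∃ i, π i = v := by
  have : Nat.card {i // π i = v} ≠ 0 := by rw [h v]; decide
  obtain ⟨⟨i, hi⟩⟩ := (Nat.card_ne_zero.1 this).1
  exact ⟨i, hi⟩

theorem IsMultisetPerm.monotone_or_antitone {n : ℕ} (hn : 3 ≤ n) {π : Fin (2 * n) → Fin n}
    (h : IsMultisetPerm n π)
    (h132 : Avoids3 n ![1, 3, 2] π) (h213 : Avoids3 n ![2, 1, 3] π)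
    (h231 : Avoids3 n ![2, 3, 1] π) (h312 : Avoids3 n ![3, 1, 2] π) :
    Monotone π ∨ Antitone π := by
  have key := lt_iff_iff_lt_iff_of_avoids h132 h213 h231 h312
  have third : ∀ i j, ∃ m, π m ≠ π i ∧ π m ≠ π j := by
    intro i j
    obtain ⟨v, hv⟩ := Finset.exists_mem_notMem_of_card_lt_card
      (s := {π i, π j}) (t := Finset.univ) (by
        rw [Finset.card_univ, Fintype.card_fin]
        exact Finset.card_le_two.trans_lt hn)
    obtain ⟨m, rfl⟩ := h.exists_eq v
    exact ⟨m, by simpa using hv⟩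
  have symm : ∀ i j, π i ≠ π j → ((i < j ↔ π i < π j) ↔ (j < i ↔ π j < π i)) := by
    intro i j hij
    have : i ≠ j := fun h ↦ hij (congrArg π h)
    grind
  have share : ∀ i j k, π i ≠ π j → π i ≠ π k →
      ((i < j ↔ π i < π j) ↔ (i < k ↔ π i < π k)) := by
    intro i j k hij hik
    by_cases hjk : π j = π k
    · obtain ⟨m, hmi, hmj⟩ := third i j
      rw [key i j m hij hmi.symm hmj.symm, key i m k hmi.symm hik (hjk ▸ hmj)]
    · exact key i j k hij hik hjk
  have all : ∀ i j k l, π i ≠ π j → π k ≠ π l →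
      ((i < j ↔ π i < π j) ↔ (k < l ↔ π k < π l)) := by
    intro i j k l hij hkl
    obtain ⟨m, hmi, hmk⟩ := third i k
    rw [share i j m hij hmi.symm, symm i m hmi.symm, share m i k hmi hmk, symm m k hmk,
      share k m l hmk.symm hkl]
  by_cases hm : Monotone π
  · exact .inl hm
  · right
    simp only [Monotone, not_forall, not_le] at hm
    obtain ⟨i, j, hij, hlt⟩ := hm
    intro k l hkl
    by_contra! hc
    have := all i j k l hlt.ne' hc.ne
    have e : i ≠ j := by rintro rfl; exact hlt.false
    have e' : k ≠ l := by rintro rfl; exact hc.false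
    grind

theorem IsMultisetPerm.card_filter_lt {n : ℕ} {π : Fin (2 * n) → Fin n}
    (h : IsMultisetPerm n π) (v : Fin n) :
    (Finset.univ.filter fun i ↦ π i < v).card = 2 * (v : ℕ) := by
  rw [Finset.card_eq_sum_card_fiberwise (f := π) (t := Finset.Iio v)
    (fun i hi ↦ by simpa using hi)]
  rw [Finset.sum_congr rfl (g := fun _ ↦ 2)]
  · simp [mul_comm]
  · intro u hu
    have hc := h u
    rw [Nat.card_eq_fintype_card, Fintype.card_subtype] at hc
    refine Eq.trans (congrArg Finset.card ?_) hc
    ext i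
    simp only [Finset.mem_Iio, Finset.mem_filter, Finset.mem_univ, true_and] at hu ⊢
    grind

theorem IsMultisetPerm.val_eq_of_monotone {n : ℕ} {π : Fin (2 * n) → Fin n}
    (h : IsMultisetPerm n π) (hm : Monotone π) (i : Fin (2 * n)) :
    (π i : ℕ) = (i : ℕ) / 2 := by
  have key : ∀ v : Fin n, π i < v ↔ (i : ℕ) < 2 * (v : ℕ) := by
    intro v
    rw [← h.card_filter_lt v]
    constructor
    · intro hv
      calc (i : ℕ) < (Finset.Iic i).card := by simp
        _ ≤ _ := Finset.card_le_card fun j hj ↦ by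
          simpa using (hm (Finset.mem_Iic.1 hj)).trans_lt hv
    · contrapose!
      intro hv
      calc _ ≤ (Finset.Iio i).card := Finset.card_le_card fun j hj ↦ by
            simp only [Finset.mem_filter, Finset.mem_univ, true_and, Finset.mem_Iio] at hj ⊢
            exact hm.reflect_lt (hj.trans_le hv)
        _ = i := by simp
  have h₁ := key (π i)
  have h₂ := key ⟨(i : ℕ) / 2, by omega⟩
  simp only [Fin.lt_def] at h₁ h₂
  omega

/-- The word `1 1 2 2 … n n`. -/
def doubledId (n : ℕ) (i : Fin (2 * n)) : Fin n := ⟨(i : ℕ) / 2, by omega⟩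

theorem doubledId_monotone (n : ℕ) : Monotone (doubledId n) :=
  fun _ _ h ↦ Nat.div_le_div_right (c := 2) h

theorem isMultisetPerm_doubledId (n : ℕ) : IsMultisetPerm n (doubledId n) := by
  intro v
  rw [Nat.card_eq_fintype_card, Fintype.card_subtype]
  have : (Finset.univ.filter fun i ↦ doubledId n i = v) =
      {⟨2 * (v : ℕ), by omega⟩, ⟨2 * (v : ℕ) + 1, by omega⟩} := by
    ext i
    simp only [doubledId, Finset.mem_filter, Finset.mem_univ, true_and, Finset.mem_insert,
      Finset.mem_singleton, Fin.ext_iff]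
    omega
  rw [this, Finset.card_pair (by simp)]

theorem IsMultisetPerm.rev_comp {n : ℕ} {π : Fin (2 * n) → Fin n} (h : IsMultisetPerm n π) :
    IsMultisetPerm n (Fin.rev ∘ π) := by
  intro v
  simpa [Fin.rev_eq_iff] using h v.rev

theorem isQuasiStirling_and_avoids {n : ℕ} {π : Fin (2 * n) → Fin n} (h : IsMultisetPerm n π)
    (hm : Monotone π ∨ Antitone π) :
    IsQuasiStirling n π ∧ Avoids3 n ![1, 3, 2] π ∧ Avoids3 n ![2, 1, 3] π ∧
      Avoids3 n ![2, 3, 1] π ∧ Avoids3 n ![3, 1, 2] π := by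
  refine ⟨⟨h, ?_, ?_⟩, ?_, ?_, ?_, ?_⟩
  · rintro ⟨i, j, k, l, hij, hjk, hkl, e₁, e₂, hlt⟩
    rcases hm with hm | hm
    · have := hm hjk.le
      order
    · have := hm hij.le
      order
  · rintro ⟨i, j, k, l, hij, hjk, hkl, e₁, e₂, hlt⟩
    rcases hm with hm | hm
    · have := hm hij.le
      order
    · have := hm hjk.le
      order
  all_goals
    rintro ⟨f, hf, hσ⟩
    have h01 : f 0 ≤ f 1 := hf.monotone (by decide)
    have h12 : f 1 ≤ f 2 := hf.monotone (by decide)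
    have l01 := hσ 0 1
    have l10 := hσ 1 0
    have l12 := hσ 1 2
    have l21 := hσ 2 1
    simp at l01 l10 l12 l21
    rcases hm with hm | hm
    · have := hm h01
      have := hm h12
      order
    · have := hm h01
      have := hm h12
      order

theorem quasiStirling_avoiding_132_213_231_312 (n : ℕ) (hn : 3 ≤ n) :
    Nat.card {π : Fin (2 * n) → Fin n //
      IsQuasiStirling n π ∧ Avoids3 n ![1, 3, 2] π ∧ Avoids3 n ![2, 1, 3] π ∧
        Avoids3 n ![2, 3, 1] π ∧ Avoids3 n ![3, 1, 2] π} = 2 := by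
  have hset : {π : Fin (2 * n) → Fin n |
      IsQuasiStirling n π ∧ Avoids3 n ![1, 3, 2] π ∧ Avoids3 n ![2, 1, 3] π ∧
        Avoids3 n ![2, 3, 1] π ∧ Avoids3 n ![3, 1, 2] π} =
      {doubledId n, Fin.rev ∘ doubledId n} := by
    ext π
    simp only [Set.mem_ofPred_eq, Set.mem_insert_iff, Set.mem_singleton_iff]
    constructor
    · rintro ⟨⟨h, -, -⟩, h132, h213, h231, h312⟩
      rcases h.monotone_or_antitone hn h132 h213 h231 h312 with hm | hm
      · exact .inl (funext fun i ↦ Fin.ext (h.val_eq_of_monotone hm i))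
      · refine .inr (funext fun i ↦ ?_)
        have hr : Monotone (Fin.rev ∘ π) := fun i j hij ↦ Fin.rev_le_rev.2 (hm hij)
        rw [Function.comp_apply, ← Fin.rev_eq_iff]
        exact Fin.ext (h.rev_comp.val_eq_of_monotone hr i)
    · rintro (rfl | rfl)
      · exact isQuasiStirling_and_avoids (isMultisetPerm_doubledId n)
          (.inl (doubledId_monotone n))
      · exact isQuasiStirling_and_avoids (isMultisetPerm_doubledId n).rev_comp
          (.inr fun i j hij ↦ Fin.rev_le_rev.2 (doubledId_monotone n hij))
  have hne : doubledId n ≠ Fin.rev ∘ doubledId n := by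
    intro he
    have := congrArg Fin.val (congrFun he ⟨0, by omega⟩)
    simp [doubledId, Fin.val_rev] at this
    omega
  exact (congrArg Set.ncard hset).trans (Set.ncard_pair hne)
end
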